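/- Let G : EuclideanSpace ℝ (Fin 3) → EuclideanSpace ℝ (Fin 3) be an infinitely differentiable map whose derivative fderiv ℝ G x is injective at every point x of the closed unit ball. Then the restriction of G to the unit sphere S² (i.e., the map x ↦ G(x) for x ∈ S²) is a smooth immersion which is homotopic through immersions to an injective smooth immersion of S² into ℝ³. (An immersed sphere bounding an immersed 3-ball is regularly homotopic to an embedded sphere.) -/

import Mathlib

open scoped Manifold

noncomputable section

/-- ℝ³ as Euclidean space. -/
abbrev E3 := EuclideanSpace ℝ (Fin 3)

/-- The unit 2-sphere in ℝ³ with its standard smooth manifold structure. -/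
abbrev S2 := Metric.sphere (0 : E3) 1

/-- A smooth immersion of the 2-sphere into ℝ³: an infinitely differentiable map whose
manifold derivative is injective at every point. -/
def IsSmoothImmersion (f : S2 → E3) : Prop :=
  ContMDiff (𝓡 2) 𝓘(ℝ, E3) (⊤ : ℕ∞) f ∧
    ∀ x : S2, Function.Injective (mfderiv (𝓡 2) 𝓘(ℝ, E3) f x)

/-- A homotopy through immersions (regular homotopy) from `f` to `g`: a smooth map
`F : ℝ × S² → ℝ³` with `F (0, ·) = f`, `F (1, ·) = g`, and `F (t, ·)` a smooth
immersion for every `t`. -/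
def IsRegularHomotopy (F : ℝ × S2 → E3) (f g : S2 → E3) : Prop :=
  ContMDiff ((𝓘(ℝ, ℝ)).prod (𝓡 2)) 𝓘(ℝ, E3) (⊤ : ℕ∞) F ∧
    (∀ x, F (0, x) = f x) ∧ (∀ x, F (1, x) = g x) ∧
    ∀ t : ℝ, IsSmoothImmersion fun x => F (t, x)

/-- The antipodal map of the 2-sphere. -/
def antipodal (x : S2) : S2 := -x

/-- The inclusion of the 2-sphere into ℝ³ is smooth. -/
theorem contMDiff_coe_S2 : ContMDiff (𝓡 2) 𝓘(ℝ, E3) (⊤ : ℕ∞) ((↑) : S2 → E3) :=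
  haveI := Fact.mk (finrank_euclideanSpace_fin (𝕜 := ℝ) (n := 2 + 1))
  contMDiff_coe_sphere

/-- The inclusion of the 2-sphere into ℝ³ has injective derivative. -/
theorem mfderiv_coe_S2_injective (x : S2) :
    Function.Injective (mfderiv (𝓡 2) 𝓘(ℝ, E3) ((↑) : S2 → E3) x) :=
  haveI := Fact.mk (finrank_euclideanSpace_fin (𝕜 := ℝ) (n := 2 + 1))
  injective_mvfderiv_subtypeVal_sphere x

/-- A smooth self-map of ℝ³ whose derivative is injective along the unit sphere restricts to
an immersion of the sphere. -/
theorem isSmoothImmersion_comp_coe {H : E3 → E3} (hH : ContDiff ℝ (⊤ : ℕ∞) H)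
    (hinj : ∀ x : S2, Function.Injective (fderiv ℝ H x)) :
    IsSmoothImmersion (fun x : S2 => H x) := by
  refine ⟨hH.contMDiff.comp contMDiff_coe_S2, fun x => ?_⟩
  have hcoe : MDifferentiableAt (𝓡 2) 𝓘(ℝ, E3) ((↑) : S2 → E3) x :=
    contMDiff_coe_S2.mdifferentiableAt (by simp)
  have hHd : MDifferentiableAt 𝓘(ℝ, E3) 𝓘(ℝ, E3) H (x : E3) :=
    (hH.differentiable (by simp)).differentiableAt.mdifferentiableAt
  have hcomp := mfderiv_comp x hHd hcoe
  rw [mfderiv_eq_fderiv] at hcomp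
  change Function.Injective (mfderiv (𝓡 2) 𝓘(ℝ, E3) (H ∘ (↑)) x)
  rw [hcomp]
  exact (hinj x).comp (mfderiv_coe_S2_injective x)

/-- If the derivative of `G` is injective on the closed unit ball, then `G` precomposed with
a scaling by `s ∈ (0, 1]` restricts to an immersion of the unit sphere. -/
theorem isSmoothImmersion_comp_smul {G : E3 → E3} (hG : ContDiff ℝ (⊤ : ℕ∞) G)
    (hG_inj : ∀ x ∈ Metric.closedBall (0 : E3) 1, Function.Injective (fderiv ℝ G x))
    {s : ℝ} (hs0 : 0 < s) (hs1 : s ≤ 1) :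
    IsSmoothImmersion (fun x : S2 => G (s • (x : E3))) := by
  refine isSmoothImmersion_comp_coe (H := fun y => G (s • y))
    (hG.comp (contDiff_id.const_smul s)) fun x => ?_
  rw [fderiv_comp_smul s]
  have hx : s • (x : E3) ∈ Metric.closedBall (0 : E3) 1 := by
    simpa [norm_smul, abs_of_pos hs0] using hs1
  exact (smul_right_injective E3 hs0.ne').comp (hG_inj _ hx)

/-- A strictly differentiable self-map of a finite-dimensional space with injective derivative
at a point is injective near that point. -/
theorem HasStrictFDerivAt.exists_injOn_ball {V : Type*} [NormedAddCommGroup V] [NormedSpace ℝ V]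
    [FiniteDimensional ℝ V] {f : V → V} {f' : V →L[ℝ] V} {a : V}
    (hf : HasStrictFDerivAt f f' a) (hinj : Function.Injective f') :
    ∃ r > 0, Set.InjOn f (Metric.ball a r) := by
  have : CompleteSpace V := FiniteDimensional.complete ℝ V
  let A : V ≃L[ℝ] V :=
    (LinearEquiv.ofInjectiveEndo (f' : V →ₗ[ℝ] V) hinj).toContinuousLinearEquiv
  have hA : (A : V →L[ℝ] V) = f' := by ext v; rfl
  rw [← hA] at hf
  obtain ⟨r, hr, hball⟩ := Metric.mem_nhds_iff.1
    ((hf.toOpenPartialHomeomorph f).open_source.mem_nhds hf.mem_toOpenPartialHomeomorph_source)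
  exact ⟨r, hr, (hf.toOpenPartialHomeomorph f).injOn.mono hball⟩

/-- An immersed sphere bounding an immersed 3-ball is regularly homotopic to an embedded
sphere: if `G : ℝ³ → ℝ³` is smooth with `fderiv ℝ G x` injective at every point of the
closed unit ball, then the restriction of `G` to the unit sphere is a smooth immersion
which is homotopic through immersions to an injective smooth immersion. -/
theorem immersed_ball_boundary_regularly_homotopic_to_embedding
    (G : E3 → E3) (hG : ContDiff ℝ (⊤ : ℕ∞) G)
    (hG_inj : ∀ x ∈ Metric.closedBall (0 : E3) 1, Function.Injective (fderiv ℝ G x)) :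
    IsSmoothImmersion (fun x : S2 => G x) ∧
    ∃ (e : S2 → E3) (F : ℝ × S2 → E3),
      IsSmoothImmersion e ∧ Function.Injective e ∧
      IsRegularHomotopy F (fun x : S2 => G x) e := by
  have hscale {s : ℝ} (hs0 : 0 < s) (hs1 : s ≤ 1) :=
    isSmoothImmersion_comp_smul hG hG_inj hs0 hs1
  obtain ⟨r, hr, hinj⟩ := ((hG.contDiffAt (x := 0)).hasStrictFDerivAt
    (by simp)).exists_injOn_ball (hG_inj 0 (by simp))
  obtain ⟨ε, hε0, hε⟩ := exists_between (lt_min hr one_pos)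
  obtain ⟨hεr, hε1⟩ := lt_min_iff.1 hε
  let σ : ℝ → ℝ := fun t => 1 - (1 - ε) * Real.smoothTransition t
  have hσ : ContDiff ℝ (⊤ : ℕ∞) σ :=
    contDiff_const.sub (contDiff_const.mul Real.smoothTransition.contDiff)
  have hσ0 (t : ℝ) : 0 < σ t := by
    have := mul_le_mul_of_nonneg_left (Real.smoothTransition.le_one t) (sub_pos.2 hε1).le
    simp only [σ]
    linarith
  have hσ1 (t : ℝ) : σ t ≤ 1 :=
    sub_le_self 1 (mul_nonneg (sub_pos.2 hε1).le (Real.smoothTransition.nonneg t))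
  refine ⟨by simpa using hscale one_pos le_rfl,
    fun x => G (ε • (x : E3)), fun p => G (σ p.1 • (p.2 : E3)), hscale hε0 hε1.le,
    fun x y hxy => ?_, ?_, fun x => by simp [σ], fun x => by simp [σ],
    fun t => hscale (hσ0 t) (hσ1 t)⟩
  · have hmem (z : S2) : ε • (z : E3) ∈ Metric.ball (0 : E3) r := by
      simpa [norm_smul, abs_of_pos hε0] using hεr
    exact Subtype.ext (smul_right_injective E3 hε0.ne' (hinj (hmem x) (hmem y) hxy))
  · exact hG.contMDiff.comp ((hσ.contMDiff.comp contMDiff_fst).smul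
      (contMDiff_coe_S2.comp contMDiff_snd))
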